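/- arXiv:2310.09128 — 2 statements merged into one kernel-verified Lean document; each statement's English description precedes it below -/
import Mathlib

section
/- If G is a connected graph on 9 vertices with maximum degree at most 4 and ι(G, C_4) ≥ 2, then G is isomorphic to one of the six graphs G_1, G_2, G_3, G_4, G_5, G_6 in G_9. -/
open SimpleGraph

/-- The closed neighbourhood `N[D]` of a set `D` of vertices of `G`. -/
def closedNbhd {V : Type*} (G : SimpleGraph V) (D : Set V) : Set V :=
  D ∪ {v | ∃ u ∈ D, G.Adj u v}

/-- `G` contains a subgraph isomorphic to `H` (a copy of `H`). -/
def HasCopy {W V : Type*} (H : SimpleGraph W) (G : SimpleGraph V) : Prop :=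
  ∃ f : W ↪ V, ∀ ⦃a b⦄, H.Adj a b → G.Adj (f a) (f b)

/-- `D` is an `H`-isolating set of `G` (single graph `H`). -/
def IsIsolating {W V : Type*} (H : SimpleGraph W) (G : SimpleGraph V) (D : Set V) : Prop :=
  ¬ HasCopy H (G.induce (closedNbhd G D)ᶜ)

/-- The `H`-isolation number of `G` (single graph `H`). -/
noncomputable def isolNum {W V : Type*} (H : SimpleGraph W) (G : SimpleGraph V) : ℕ :=
  sInf {k | ∃ D : Set V, D.ncard = k ∧ IsIsolating H G D}

/-- `D` is an `F`-isolating set of `G`, for a set `F` of graphs. -/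
def IsIsolatingFam {V : Type*} (F : Set ((n : ℕ) × SimpleGraph (Fin n)))
    (G : SimpleGraph V) (D : Set V) : Prop :=
  ∀ H ∈ F, ¬ HasCopy H.2 (G.induce (closedNbhd G D)ᶜ)

/-- The `F`-isolation number of `G`, for a set `F` of graphs. -/
noncomputable def isolNumFam {V : Type*} (F : Set ((n : ℕ) × SimpleGraph (Fin n)))
    (G : SimpleGraph V) : ℕ :=
  sInf {k | ∃ D : Set V, D.ncard = k ∧ IsIsolatingFam F G D}

/-- The 4-cycle. -/
def C4 : SimpleGraph (Fin 4) := cycleGraph 4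

/-- The diamond graph: a 4-cycle together with a chord. -/
def diamondGraph : SimpleGraph (Fin 4) :=
  fromEdgeSet {s(0, 1), s(1, 2), s(2, 3), s(3, 0), s(0, 2)}

/-- The complete graph on 4 vertices. -/
def K4 : SimpleGraph (Fin 4) := ⊤

/-- `G₁`: the square of the 9-cycle. -/
def Gr1 : SimpleGraph (Fin 9) :=
  fromEdgeSet {s(0, 1), s(1, 2), s(2, 3), s(3, 4), s(4, 5), s(5, 6), s(6, 7), s(7, 8), s(8, 0),
    s(0, 2), s(1, 3), s(2, 4), s(3, 5), s(4, 6), s(5, 7), s(6, 8), s(7, 0), s(8, 1)}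

/-- `G₂`. -/
def Gr2 : SimpleGraph (Fin 9) :=
  fromEdgeSet {s(0, 1), s(0, 5), s(0, 6), s(0, 8), s(1, 2), s(1, 7), s(1, 8), s(2, 3), s(2, 6),
    s(2, 7), s(3, 4), s(3, 6), s(3, 8), s(4, 5), s(4, 7), s(4, 8), s(5, 6), s(5, 7)}

/-- `G₃`. -/
def Gr3 : SimpleGraph (Fin 9) :=
  fromEdgeSet {s(0, 1), s(0, 5), s(0, 6), s(0, 8), s(1, 2), s(1, 7), s(1, 8), s(2, 3), s(2, 7),
    s(2, 8), s(3, 4), s(3, 6), s(3, 8), s(4, 5), s(4, 6), s(4, 7), s(5, 6), s(5, 7)}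

/-- `G₄`. -/
def Gr4 : SimpleGraph (Fin 9) :=
  fromEdgeSet {s(0, 1), s(0, 2), s(0, 3), s(0, 4), s(1, 2), s(1, 5), s(1, 6), s(2, 5), s(2, 6),
    s(3, 4), s(3, 7), s(3, 8), s(4, 7), s(4, 8), s(5, 6), s(5, 8), s(6, 7), s(7, 8)}

/-- `G₅`: `G₄` with the edge `{2,3}` removed. -/
def Gr5 : SimpleGraph (Fin 9) :=
  fromEdgeSet {s(0, 1), s(0, 2), s(0, 3), s(0, 4), s(1, 5), s(1, 6), s(2, 5), s(2, 6),
    s(3, 4), s(3, 7), s(3, 8), s(4, 7), s(4, 8), s(5, 6), s(5, 8), s(6, 7), s(7, 8)}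

/-- `G₆`: `G₅` with the edge `{4,5}` removed. -/
def Gr6 : SimpleGraph (Fin 9) :=
  fromEdgeSet {s(0, 1), s(0, 2), s(0, 3), s(0, 4), s(1, 5), s(1, 6), s(2, 5), s(2, 6),
    s(3, 7), s(3, 8), s(4, 7), s(4, 8), s(5, 6), s(5, 8), s(6, 7), s(7, 8)}

/-- The set `𝒢₄ = {C₄, C₄', K₄}` of 4-vertex exceptional graphs. -/
def calG4 : Set ((n : ℕ) × SimpleGraph (Fin n)) := {⟨4, C4⟩, ⟨4, diamondGraph⟩, ⟨4, K4⟩}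

/-- The set `𝒢₉ = {G₁, …, G₆}` of 9-vertex exceptional graphs. -/
def calG9 : Set ((n : ℕ) × SimpleGraph (Fin n)) :=
  {⟨9, Gr1⟩, ⟨9, Gr2⟩, ⟨9, Gr3⟩, ⟨9, Gr4⟩, ⟨9, Gr5⟩, ⟨9, Gr6⟩}

/-- The set `ℰ₄ = 𝒢₄ ∪ 𝒢₉` of exceptional graphs. -/
def calE4 : Set ((n : ℕ) × SimpleGraph (Fin n)) := calG4 ∪ calG9

namespace GraphCode

/-- `f n`, arranged so that the kernel evaluates `n` before it unfolds `f`. -/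
def force {α : Type} (n : ℕ) (f : ℕ → α) : α := Nat.casesOn n (f 0) fun k => f k.succ

/-- Bit `i` of `x`. -/
def bit (x i : ℕ) : Bool := ((x >>> i) % 2).beq 1

/-- Whether some vertex satisfies `f`. -/
def anyVert (f : ℕ → Bool) : Bool :=
  f 0 || (f 1 || (f 2 || (f 3 || (f 4 || (f 5 || (f 6 || (f 7 || f 8)))))))

/-- Whether all vertices satisfy `f`. -/
def allVert (f : ℕ → Bool) : Bool :=
  f 0 && (f 1 && (f 2 && (f 3 && (f 4 && (f 5 && (f 6 && (f 7 && f 8)))))))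

/-- A graph on `{0, …, 8}` is coded by the natural number whose bit `9 * i + j` says whether
`i` and `j` are adjacent. -/
def adj (g i j : ℕ) : Bool := bit g (9 * i + j)

/-- The code of the graph whose only edge is `{i, j}`. -/
def edgeCode (i j : ℕ) : ℕ := 1 <<< (9 * i + j) ||| 1 <<< (9 * j + i)

/-- The code of the graph with a given list of edges. -/
def edgesCode (l : List (ℕ × ℕ)) : ℕ := l.foldr (fun e g => edgeCode e.1 e.2 ||| g) 0

/-- The neighbourhood of `i`, as a bit mask. -/
def row (g i : ℕ) : ℕ := g >>> (9 * i) &&& 511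

/-- The neighbourhood of `i` in `{5, 6, 7, 8}`, as a bit mask. -/
def key (g i : ℕ) : ℕ := g >>> (9 * i + 5) &&& 15

/-- Removing the lowest bit. -/
def low (x : ℕ) : ℕ := x &&& (x - 1)

/-- Removing the lowest `d` bits. -/
def dropBits : ℕ → ℕ → ℕ
  | 0, x => x
  | d + 1, x => force (low x) (dropBits d)

/-- Whether the degree of `i` is at most `d`. -/
def degLe (d g i : ℕ) : Bool := (force (row g i) (dropBits d)).beq 0

/-- Whether `x` has at least two bits equal to one. -/
def twoBits (x : ℕ) : Bool := !(low x).beq 0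

/-- Whether the vertices in the mask `r` carry a `4`-cycle of the graph `m`. -/
def cycleIn (m r : ℕ) : Bool :=
  anyVert fun a => bit r a && force (row m a &&& r) fun s => twoBits s &&
    anyVert fun b => bit r b && (b.blt a && force (row m b &&& s) twoBits)

/-- The vertices that are neither `w` nor adjacent to `w`, as a bit mask. -/
def farMask (p w : ℕ) : ℕ := 511 ^^^ (row p w ||| 1 <<< w)

/-- Adding to the set `s` the neighbours of its element `i`, if it has this element. -/
def spreadAt (m i s : ℕ) : ℕ := bif bit s i then s ||| row m i else s

/-- The set of vertices that are reached from `8` by first using the edges at the vertices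
`8, 7, 6, 5` and then twice those at the other ones. -/
def spread (m : ℕ) : ℕ :=
  [0, 1, 2, 3, 4, 0, 1, 2, 3, 4, 5, 6, 7, 8].foldr (fun i s => force s (spreadAt m i)) 256

/-- Whether `s` is a proper set of vertices that contains `8` and is closed under adjacency. -/
def separates (m s : ℕ) : Bool :=
  bit s 8 && (!(s &&& 511).beq 511 && allVert fun i => !bit s i || (s ||| row m i).beq s)

/-- Whether `l` lists the images of the vertices of `h` under an isomorphism to `g`. -/
def relabels (h g : ℕ) (l : List ℕ) : Bool :=
  allVert fun i => allVert fun j => adj h i j == adj g (l.getD i 0) (l.getD j 0)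

/-- Codes of the exceptional graphs, each with the vertex orders in which the search meets it. -/
def exceptionalLabellings : List (ℕ × List (List ℕ)) := [
  (edgesCode [(0, 1), (0, 2), (0, 3), (0, 4), (1, 2), (1, 5), (1, 6), (2, 5), (2, 6),
      (3, 4), (3, 7), (3, 8), (4, 7), (4, 8), (5, 6), (5, 8), (6, 7), (7, 8)],
    [[2, 0, 1, 5, 6, 3, 4, 8, 7], [3, 0, 1, 5, 7, 2, 4, 8, 6], [4, 0, 1, 5, 8, 2, 3, 7, 6],
      [3, 0, 1, 6, 7, 2, 4, 8, 5], [4, 0, 1, 6, 8, 2, 3, 7, 5], [4, 0, 1, 7, 8, 2, 3, 6, 5],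
      [8, 3, 4, 5, 7, 0, 1, 6, 2], [6, 1, 2, 5, 7, 0, 3, 8, 4], [7, 2, 3, 6, 8, 0, 1, 5, 4],
      [5, 1, 2, 6, 8, 0, 3, 7, 4], [0, 1, 2, 3, 4, 6, 7, 8, 5], [0, 1, 2, 3, 4, 5, 6, 7, 8]]),
  (edgesCode [(0, 1), (0, 2), (0, 3), (0, 4), (1, 5), (1, 6), (2, 5), (2, 6),
      (3, 4), (3, 7), (3, 8), (4, 7), (4, 8), (5, 6), (5, 8), (6, 7), (7, 8)],
    [[8, 3, 4, 5, 7, 0, 1, 6, 2], [6, 1, 2, 5, 7, 0, 3, 8, 4], [4, 6, 8, 0, 1, 5, 7, 3, 2],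
      [7, 2, 3, 6, 8, 0, 1, 5, 4], [5, 1, 2, 6, 8, 0, 3, 7, 4], [3, 5, 7, 0, 1, 6, 8, 4, 2],
      [0, 1, 2, 3, 4, 6, 7, 8, 5], [0, 3, 4, 1, 2, 5, 8, 7, 6], [0, 1, 2, 3, 4, 5, 6, 7, 8],
      [0, 3, 4, 1, 2, 7, 8, 5, 6], [8, 5, 7, 3, 4, 2, 6, 1, 0], [6, 5, 7, 1, 2, 4, 8, 3, 0],
      [7, 6, 8, 2, 3, 4, 5, 1, 0], [5, 6, 8, 1, 2, 4, 7, 3, 0]]),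
  (edgesCode [(0, 1), (0, 2), (0, 3), (0, 4), (1, 5), (1, 6), (2, 5), (2, 6),
      (3, 7), (3, 8), (4, 7), (4, 8), (5, 6), (5, 8), (6, 7), (7, 8)],
    [[0, 1, 2, 3, 4, 6, 7, 8, 5], [0, 1, 2, 3, 4, 5, 6, 7, 8], [8, 3, 4, 5, 7, 0, 1, 6, 2],
      [6, 1, 2, 5, 7, 0, 3, 8, 4], [7, 2, 3, 6, 8, 0, 1, 5, 4], [5, 1, 2, 6, 8, 0, 3, 7, 4]]),
  (edgesCode [(0, 1), (0, 5), (0, 6), (0, 8), (1, 2), (1, 7), (1, 8), (2, 3), (2, 7),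
      (2, 8), (3, 4), (3, 6), (3, 8), (4, 5), (4, 6), (4, 7), (5, 6), (5, 7)],
    [[1, 0, 4, 8, 7, 6, 5, 2, 3], [1, 0, 3, 8, 7, 6, 5, 2, 4], [3, 0, 2, 6, 7, 8, 5, 4, 1],
      [3, 0, 1, 6, 7, 8, 5, 4, 2], [1, 0, 3, 7, 8, 5, 6, 4, 2], [1, 0, 2, 7, 8, 5, 6, 4, 3],
      [3, 0, 2, 5, 8, 7, 6, 4, 1], [3, 0, 1, 5, 8, 7, 6, 4, 2], [0, 1, 6, 7, 8, 3, 4, 5, 2],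
      [0, 1, 5, 8, 7, 2, 4, 6, 3]]),
  (edgesCode [(0, 1), (1, 2), (2, 3), (3, 4), (4, 5), (5, 6), (6, 7), (7, 8), (8, 0),
      (0, 2), (1, 3), (2, 4), (3, 5), (4, 6), (5, 7), (6, 8), (7, 0), (8, 1)],
    [[0, 1, 2, 6, 7, 5, 8, 4, 3], [0, 1, 2, 6, 5, 7, 8, 4, 3], [0, 1, 4, 5, 8, 6, 7, 3, 2],
      [0, 1, 2, 5, 6, 8, 7, 4, 3]]),
  (edgesCode [(0, 1), (0, 5), (0, 6), (0, 8), (1, 2), (1, 7), (1, 8), (2, 3), (2, 6),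
      (2, 7), (3, 4), (3, 6), (3, 8), (4, 5), (4, 7), (4, 8), (5, 6), (5, 7)],
    [[0, 1, 5, 8, 7, 2, 3, 6, 4]])]

/-- Whether the graph `g` is exceptional. -/
def exceptional (g : ℕ) : Bool :=
  exceptionalLabellings.any fun c => force c.1 fun h => c.2.any (relabels h g)

/-- A step of the search: branching on an edge, or one of the tests that discard a branch. -/
inductive Step
  | edge (i j : ℕ)
  | cycle (w : ℕ)
  | sorted (i : ℕ)
  | connected

/-- The search through the graphs `g` of maximum degree at most `d` with `p ⊆ g ⊆ m`. The result
is `true` if all graphs that are not discarded are exceptional. -/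
def search (d : ℕ) : List Step → ℕ → ℕ → Bool
  | [], p, m => p.beq m && exceptional p
  | .edge i j :: l, p, m =>
    (force (p ||| edgeCode i j) fun q => !(degLe d q i && degLe d q j) || search d l q m) &&
      force (m ^^^ (m &&& edgeCode i j)) fun n => search d l p n
  | .cycle w :: l, p, m => !force (farMask p w) (cycleIn m) || search d l p m
  | .sorted i :: l, p, m => !(key p i).ble (key m (i + 1)) || search d l p m
  | .connected :: l, p, m => force (spread m) (separates m) || search d l p m

/-- The complete graph. -/
def fullCode : ℕ := edgesCode [(0, 1), (0, 2), (0, 3), (0, 4), (0, 5), (0, 6), (0, 7), (0, 8),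
  (1, 2), (1, 3), (1, 4), (1, 5), (1, 6), (1, 7), (1, 8), (2, 3), (2, 4), (2, 5), (2, 6), (2, 7),
  (2, 8), (3, 4), (3, 5), (3, 6), (3, 7), (3, 8), (4, 5), (4, 6), (4, 7), (4, 8), (5, 6), (5, 7),
  (5, 8), (6, 7), (6, 8), (7, 8)]

/-- The edges of the `4`-cycle on the last four vertices. -/
def squareEdges : List (ℕ × ℕ) := [(5, 6), (6, 7), (7, 8), (8, 5)]

/-- The search steps for graphs of maximum degree at most three. -/
def stepsThree : List Step := [.edge 5 7, .edge 6 8,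
  .edge 0 8, .edge 0 7, .edge 0 6, .edge 0 5,
  .edge 1 8, .edge 1 7, .edge 1 6, .edge 1 5, .sorted 0,
  .edge 2 8, .edge 2 7, .edge 2 6, .edge 2 5, .sorted 1,
  .edge 3 8, .edge 3 7, .edge 3 6, .edge 3 5, .sorted 2,
  .edge 4 8, .edge 4 7, .edge 4 6, .edge 4 5, .sorted 3, .connected,
  .edge 3 4, .edge 2 4, .edge 1 4, .cycle 4, .cycle 5, .cycle 6, .cycle 7,
  .edge 0 4, .cycle 4, .edge 2 3, .edge 1 3, .cycle 3, .cycle 8,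
  .edge 0 3, .edge 1 2, .cycle 4, .edge 0 2, .edge 0 1, .connected]

/-- The search steps for graphs in which the vertex `0` has the neighbours `1, 2, 3, 4`. -/
def stepsFour : List Step := [.edge 5 7, .edge 6 8,
  .edge 1 8, .edge 1 7, .edge 1 6, .edge 1 5,
  .edge 2 8, .edge 2 7, .edge 2 6, .edge 2 5, .sorted 1,
  .edge 3 8, .edge 3 7, .edge 3 6, .edge 3 5, .sorted 2,
  .edge 4 8, .cycle 8, .edge 4 7, .cycle 7, .edge 4 6, .edge 4 5, .sorted 3,
  .edge 3 4, .cycle 3, .edge 2 4, .cycle 2, .cycle 5, .edge 1 4, .cycle 3, .cycle 4,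
  .edge 2 3, .edge 1 3, .cycle 2, .cycle 5, .edge 1 2, .cycle 1, .cycle 4, .cycle 6,
  .cycle 7, .cycle 8, .connected]

/-- The graph on `{0, …, 8}` with the edges that are fixed in the second search. -/
def starSquareCode : ℕ := edgesCode ([(0, 1), (0, 2), (0, 3), (0, 4)] ++ squareEdges)

/-- The graph on `{0, …, 8}` with the edges that are allowed in the second search. -/
def starSquareBound : ℕ := fullCode ^^^ edgesCode [(0, 5), (0, 6), (0, 7), (0, 8)]

theorem search_three : search 3 stepsThree (edgesCode squareEdges) fullCode = true := by
  decide +kernel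

set_option maxHeartbeats 4000000 in
theorem search_four : search 4 stepsFour starSquareCode starSquareBound = true := by
  decide +kernel

@[simp] theorem force_eq {α : Type} (n : ℕ) (f : ℕ → α) : force n f = f n := by
  cases n <;> rfl

@[simp] theorem bit_eq (x i : ℕ) : bit x i = x.testBit i := by
  rw [bit, Nat.testBit_eq_decide_div_mod_eq, Nat.shiftRight_eq_div_pow]
  exact Bool.eq_iff_iff.2 (by rw [Nat.beq_eq, decide_eq_true_eq])

theorem anyVert_of {f : ℕ → Bool} {i : ℕ} (hi : i < 9) (h : f i = true) : anyVert f = true := by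
  unfold anyVert
  interval_cases i <;> simp [h]

theorem of_allVert {f : ℕ → Bool} (h : allVert f = true) {i : ℕ} (hi : i < 9) : f i = true := by
  simp only [allVert, Bool.and_eq_true] at h
  interval_cases i <;> simp [h]

theorem adj_eq (g i j : ℕ) : adj g i j = g.testBit (9 * i + j) := bit_eq _ _

theorem testBit_row {g i j : ℕ} (hj : j < 9) : (row g i).testBit j = adj g i j := by
  have h : (511 : ℕ) = 2 ^ 9 - 1 := rfl
  rw [row, adj_eq, Nat.testBit_and, h, Nat.testBit_two_pow_sub_one, Nat.testBit_shiftRight,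
    decide_eq_true hj, Bool.and_true]

theorem row_lt (g i : ℕ) : row g i < 512 :=
  Nat.and_lt_two_pow (n := 9) _ (by norm_num)

theorem testBit_key {g i t : ℕ} : (key g i).testBit t = (decide (t < 4) && adj g i (5 + t)) := by
  have h : (15 : ℕ) = 2 ^ 4 - 1 := rfl
  rw [key, adj_eq, Nat.testBit_and, h, Nat.testBit_two_pow_sub_one, Nat.testBit_shiftRight,
    Bool.and_comm, add_assoc]

theorem adj_edgeCode {a b i j : ℕ} (hb : b < 9) (ha : a < 9) (hj : j < 9) :
    adj (edgeCode a b) i j = true ↔ a = i ∧ b = j ∨ a = j ∧ b = i := by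
  simp only [adj_eq, edgeCode, Nat.testBit_or, Nat.one_shiftLeft, Nat.testBit_two_pow,
    Bool.or_eq_true, decide_eq_true_eq]
  omega

/-- The number of elements of a set of vertices given as a bit mask. -/
def size (x : ℕ) : ℕ := (Finset.univ.filter fun j : Fin 9 => x.testBit j = true).card

theorem size_low {x : ℕ} (hx : x < 512) : size (low x) = size x - 1 := by
  revert x
  decide +kernel

theorem size_eq_zero {x : ℕ} (hx : x < 512) : size x = 0 ↔ x = 0 := by
  revert x
  decide +kernel

theorem dropBits_eq_zero {d x : ℕ} (hx : x < 512) : dropBits d x = 0 ↔ size x ≤ d := by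
  induction d generalizing x with
  | zero => rw [dropBits, Nat.le_zero, size_eq_zero hx]
  | succ d ih =>
    have hlow : low x < 512 := Nat.and_le_left.trans_lt hx
    rw [dropBits, force_eq, ih hlow, size_low hx, Nat.sub_le_iff_le_add]

theorem degLe_iff {d g i : ℕ} :
    degLe d g i = true ↔ (Finset.univ.filter fun j : Fin 9 => adj g i j = true).card ≤ d := by
  rw [degLe, force_eq, Nat.beq_eq, dropBits_eq_zero (row_lt g i), size]
  simp only [testBit_row (Fin.is_lt _)]

theorem twoBits_of {x u v : ℕ} (hu : x.testBit u = true) (hv : x.testBit v = true) (h : u ≠ v) :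
    twoBits x = true := by
  rw [twoBits, Bool.not_eq_true', Bool.eq_false_iff, ne_eq, Nat.beq_eq]
  intro h0
  have hx : x ≠ 0 := by
    rintro rfl
    simp at hu
  obtain ⟨k, rfl⟩ := (Nat.ne_zero_and_sub_one_eq_zero_iff_isPowerOfTwo).1 ⟨hx, h0⟩
  rw [Nat.testBit_two_pow, decide_eq_true_eq] at hu hv
  exact h (hu.symm.trans hv)

theorem testBit_farMask {p w a : ℕ} (ha : a < 9) (hw : a ≠ w) (h : adj p w a = false) :
    (farMask p w).testBit a = true := by
  have h9 : (511 : ℕ) = 2 ^ 9 - 1 := rfl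
  rw [farMask, Nat.testBit_xor, Nat.testBit_or, testBit_row ha, h, Nat.one_shiftLeft,
    Nat.testBit_two_pow_of_ne hw.symm, h9, Nat.testBit_two_pow_sub_one]
  simpa using ha

/-- The edges of `p` are edges of `g`. -/
def Sub (p g : ℕ) : Prop := ∀ ⦃i j⦄, i < 9 → j < 9 → adj p i j = true → adj g i j = true

/-- Four vertices spanning a `4`-cycle of `g` and not in the closed neighbourhood of `w`. -/
structure FarCycle (g w : ℕ) (c : Fin 4 → ℕ) : Prop where
  injective : Function.Injective c
  lt : ∀ k, c k < 9
  ne : ∀ k, c k ≠ w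
  far : ∀ k, adj g w (c k) = false
  adj : ∀ k, adj g (c k) (c (k + 1)) = true

/-- The properties of a coded graph that are used in the search. -/
structure Admissible (d s g : ℕ) : Prop where
  symm : ∀ ⦃i j⦄, i < 9 → j < 9 → adj g i j = true → adj g j i = true
  degLe : ∀ ⦃i⦄, i < 9 → degLe d g i = true
  farCycle : ∀ ⦃w⦄, w < 9 → ∃ c, FarCycle g w c
  key_le : ∀ ⦃i⦄, s ≤ i → i < 4 → key g i ≤ key g (i + 1)
  connected : ∀ t : ℕ, t.testBit 8 = true →
    (∀ i j, i < 9 → j < 9 → t.testBit i = true → adj g i j = true → t.testBit j = true) →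
    ∀ i, i < 9 → t.testBit i = true

theorem degLe_mono {d p g i : ℕ} (h : Sub p g) (hi : i < 9) (hg : degLe d g i = true) :
    degLe d p i = true := by
  rw [degLe_iff] at hg ⊢
  exact (Finset.card_le_card (Finset.monotone_filter_right _
    fun j _ hj => h hi j.is_lt hj)).trans hg

theorem key_mono {p g i : ℕ} (h : Sub p g) (hi : i < 9) : key p i ≤ key g i := by
  have : key p i &&& key g i = key p i := by
    apply Nat.eq_of_testBit_eq
    intro t
    rw [Nat.testBit_and, testBit_key, testBit_key]
    by_cases ht : t < 4
    · have := h hi (show 5 + t < 9 by omega)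
      cases hp : adj p i (5 + t) <;> simp_all
    · simp [ht]
  rw [← this]
  exact Nat.and_le_right

theorem cycleIn_of_lt {m r a b u v : ℕ} (ha : a < 9) (hu : u < 9) (hv : v < 9) (hba : b < a)
    (huv : u ≠ v) (hra : r.testBit a = true) (hrb : r.testBit b = true)
    (hru : r.testBit u = true) (hrv : r.testBit v = true)
    (hau : adj m a u = true) (hav : adj m a v = true) (hbu : adj m b u = true)
    (hbv : adj m b v = true) : cycleIn m r = true := by
  have key : ∀ k, k < 9 → r.testBit k = true → adj m a k = true →
      (row m a &&& r).testBit k = true := fun k hk hr h => by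
    rw [Nat.testBit_and, testBit_row hk, h, hr]; rfl
  have key' : ∀ k, k < 9 → r.testBit k = true → adj m a k = true → adj m b k = true →
      (row m b &&& (row m a &&& r)).testBit k = true := fun k hk hr h h' => by
    rw [Nat.testBit_and, key k hk hr h, testBit_row hk, h']; rfl
  refine anyVert_of ha ?_
  rw [bit_eq, hra, force_eq, twoBits_of (key u hu hru hau) (key v hv hrv hav) huv, Bool.true_and,
    Bool.true_and]
  refine anyVert_of (hba.trans ha) ?_
  rw [bit_eq, hrb, force_eq, twoBits_of (key' u hu hru hau hbu) (key' v hv hrv hav hbv) huv]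
  simpa [Nat.blt_eq] using hba

theorem Admissible.cycleIn {d s g p m w : ℕ} (hg : Admissible d s g) (hp : Sub p g) (hm : Sub g m)
    (hw : w < 9) : cycleIn m (farMask p w) = true := by
  obtain ⟨c, hc⟩ := hg.farCycle hw
  have far : ∀ k, (farMask p w).testBit (c k) = true := fun k =>
    testBit_farMask (hc.lt k) (hc.ne k) (by
      rw [← Bool.not_eq_true]
      intro h
      have := hp hw (hc.lt k) h
      rw [hc.far k] at this
      exact Bool.false_ne_true this)
  have hadj : ∀ k l, l = k + 1 → GraphCode.adj m (c k) (c l) = true := fun k l h =>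
    h ▸ hm (hc.lt _) (hc.lt _) (hc.adj k)
  have hadj' : ∀ k l, l = k + 1 → GraphCode.adj m (c l) (c k) = true := fun k l h =>
    h ▸ hm (hc.lt _) (hc.lt _) (hg.symm (hc.lt _) (hc.lt _) (hc.adj k))
  have h13 : c 1 ≠ c 3 := fun h => absurd (hc.injective h) (by decide)
  have h02 : c 0 ≠ c 2 := fun h => absurd (hc.injective h) (by decide)
  rcases h02.lt_or_gt with h | h
  · exact cycleIn_of_lt (hc.lt 2) (hc.lt 1) (hc.lt 3) h h13 (far _) (far _) (far _) (far _)
      (hadj' 1 2 rfl) (hadj 2 3 rfl) (hadj 0 1 rfl) (hadj' 3 0 rfl)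
  · exact cycleIn_of_lt (hc.lt 0) (hc.lt 1) (hc.lt 3) h h13 (far _) (far _) (far _) (far _)
      (hadj 0 1 rfl) (hadj' 3 0 rfl) (hadj' 1 2 rfl) (hadj 2 3 rfl)

theorem Admissible.not_separates {d s g m t : ℕ} (hg : Admissible d s g) (hm : Sub g m) :
    separates m t = false := by
  rw [← Bool.not_eq_true]
  intro h
  simp only [separates, Bool.and_eq_true, bit_eq, Bool.not_eq_true', Bool.eq_false_iff, ne_eq,
    Nat.beq_eq] at h
  obtain ⟨h8, hne, hcl⟩ := h
  have hall := hg.connected t h8 fun i j hi hj hti hij => by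
    have := of_allVert hcl hi
    rw [hti, Bool.not_true, Bool.false_or, Nat.beq_eq] at this
    rw [← this, Nat.testBit_or, testBit_row hj, hm hi hj hij, Bool.or_true]
  apply hne
  apply Nat.eq_of_testBit_eq
  intro k
  have h9 : (511 : ℕ) = 2 ^ 9 - 1 := rfl
  rw [Nat.testBit_and, h9, Nat.testBit_two_pow_sub_one]
  by_cases hk : k < 9
  · simp [hk, hall k hk]
  · simp [hk]

/-- Whether the step of a search makes sense, where the keys are sorted from `s` on. -/
def Step.valid (s : ℕ) : Step → Bool
  | .edge i j => decide (i < 9 ∧ j < 9)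
  | .cycle w => decide (w < 9)
  | .sorted i => decide (s ≤ i ∧ i < 4)
  | .connected => true

theorem Sub.or {p q g : ℕ} (hp : Sub p g) (hq : Sub q g) : Sub (p ||| q) g := by
  intro i j hi hj h
  rw [adj_eq, Nat.testBit_or, ← adj_eq, ← adj_eq, Bool.or_eq_true] at h
  exact h.elim (hp hi hj) (hq hi hj)

theorem search_sound {d s g : ℕ} (hg : Admissible d s g) {l : List Step}
    (hl : l.all (Step.valid s) = true) {p m : ℕ} (hp : Sub p g) (hm : Sub g m)
    (h : search d l p m = true) :
    ∃ p, exceptional p = true ∧ ∀ i j, i < 9 → j < 9 → adj p i j = adj g i j := by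
  induction l generalizing p m with
  | nil =>
    rw [search, Bool.and_eq_true, Nat.beq_eq] at h
    obtain ⟨rfl, h⟩ := h
    exact ⟨p, h, fun i j hi hj => Bool.eq_iff_iff.2 ⟨hp hi hj, hm hi hj⟩⟩
  | cons a l ih =>
    rw [List.all_cons, Bool.and_eq_true] at hl
    obtain ⟨ha, hl⟩ := hl
    cases a with
    | edge i j =>
      obtain ⟨hi, hj⟩ := of_decide_eq_true ha
      rw [search, force_eq, force_eq, Bool.and_eq_true] at h
      cases hij : adj g i j with
      | true =>
        have hp' : Sub (p ||| edgeCode i j) g := hp.or fun a b _ hb hab => by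
          rcases (adj_edgeCode hj hi hb).1 hab with ⟨rfl, rfl⟩ | ⟨rfl, rfl⟩
          · exact hij
          · exact hg.symm hi hj hij
        rw [degLe_mono hp' hi (hg.degLe hi), degLe_mono hp' hj (hg.degLe hj)] at h
        exact ih hl hp' hm h.1
      | false =>
        refine ih hl hp (fun a b ha hb hab => ?_) h.2
        have hne : adj (edgeCode i j) a b = false := by
          rw [← Bool.not_eq_true, adj_edgeCode hj hi hb]
          rintro (⟨rfl, rfl⟩ | ⟨rfl, rfl⟩)
          · exact Bool.false_ne_true (hij.symm.trans hab)
          · exact Bool.false_ne_true (hij.symm.trans (hg.symm ha hb hab))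
        have hma := hm ha hb hab
        rw [adj_eq] at hne hma ⊢
        rw [Nat.testBit_xor, Nat.testBit_and, hne, hma]
        rfl
    | cycle w =>
      rw [search, force_eq, hg.cycleIn hp hm (of_decide_eq_true ha)] at h
      exact ih hl hp hm h
    | sorted i =>
      obtain ⟨hs, hi⟩ := of_decide_eq_true ha
      have hle : key p i ≤ key m (i + 1) :=
        (key_mono hp (by omega)).trans ((hg.key_le hs hi).trans (key_mono hm (by omega)))
      rw [search, Nat.ble_eq_true_of_le hle] at h
      exact ih hl hp hm h
    | connected =>
      rw [search, force_eq, hg.not_separates hm] at h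
      exact ih hl hp hm h

open scoped Classical in
/-- The code of a graph on nine vertices. -/
noncomputable def encode (H : SimpleGraph (Fin 9)) : ℕ :=
  Nat.ofBits fun k : Fin (9 * 9) => decide (H.Adj (k.divNat) (k.modNat))

theorem adj_encode (H : SimpleGraph (Fin 9)) (i j : Fin 9) :
    adj (encode H) i j = true ↔ H.Adj i j := by
  classical
  have h : 9 * (i : ℕ) + j < 9 * 9 := by omega
  rw [adj_eq, encode, Nat.testBit_ofBits_lt _ _ h, decide_eq_true_eq]
  have h1 : Fin.divNat ⟨9 * (i : ℕ) + j, h⟩ = i := by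
    ext; simp only [Fin.coe_divNat]; omega
  have h2 : Fin.modNat ⟨9 * (i : ℕ) + j, h⟩ = j := by
    ext; simp only [Fin.coe_modNat]; omega
  rw [h1, h2]

theorem exists_exceptional {H : SimpleGraph (Fin 9)} {g : ℕ}
    (hg : ∀ i j : Fin 9, adj g i j = true ↔ H.Adj i j) (h : exceptional g = true) :
    ∃ K : SimpleGraph (Fin 9), (∃ c ∈ exceptionalLabellings.map Prod.fst,
      ∀ i j : Fin 9, adj c i j = true ↔ K.Adj i j) ∧ Nonempty (H ≃g K) := by
  obtain ⟨⟨c, L⟩, hc, h⟩ := List.any_eq_true.1 h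
  rw [force_eq] at h
  obtain ⟨l, hl, h⟩ := List.any_eq_true.1 h
  have hperm : ∀ c ∈ exceptionalLabellings, ∀ l ∈ c.2, (∀ i : Fin 9, l.getD i 0 < 9) ∧
      ∀ i j : Fin 9, l.getD i 0 = l.getD j 0 → i = j := by
    decide +kernel
  obtain ⟨hlt, hinj⟩ := hperm _ hc l hl
  let f : Fin 9 → Fin 9 := fun i => ⟨l.getD i 0, hlt i⟩
  have hf : Function.Injective f := fun i j hij => hinj i j (Fin.mk.inj_iff.1 hij)
  let e : Fin 9 ≃ Fin 9 := Equiv.ofBijective f (Finite.injective_iff_bijective.1 hf)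
  refine ⟨H.comap e, ⟨c, List.mem_map.2 ⟨_, hc, rfl⟩, fun i j => ?_⟩, ⟨(Iso.comap e H).symm⟩⟩
  have hij := of_allVert (of_allVert h i.is_lt) j.is_lt
  rw [beq_iff_eq] at hij
  rw [hij]
  exact hg (f i) (f j)

theorem mem_of_exceptionalLabellings {K : SimpleGraph (Fin 9)} {c : ℕ}
    (hc : c ∈ exceptionalLabellings.map Prod.fst)
    (h : ∀ i j : Fin 9, adj c i j = true ↔ K.Adj i j) :
    K ∈ ({Gr1, Gr2, Gr3, Gr4, Gr5, Gr6} : Set (SimpleGraph (Fin 9))) := by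
  have key : ∀ {K' : SimpleGraph (Fin 9)},
      (∀ i j : Fin 9, adj c i j = true ↔ K'.Adj i j) → K = K' := fun h' => by
    ext i j
    rw [← h, ← h']
  simp only [exceptionalLabellings, List.map_cons, List.map_nil, List.mem_cons, List.not_mem_nil,
    or_false] at hc
  simp only [Set.mem_insert_iff, Set.mem_singleton_iff]
  rcases hc with hc | hc | hc | hc | hc | hc
  · refine Or.inr (Or.inr (Or.inr (Or.inl (key ?_))))
    simp only [Gr4, fromEdgeSet_adj, Set.mem_insert_iff, Set.mem_singleton_iff]
    subst hc
    decide +kernel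
  · refine Or.inr (Or.inr (Or.inr (Or.inr (Or.inl (key ?_)))))
    simp only [Gr5, fromEdgeSet_adj, Set.mem_insert_iff, Set.mem_singleton_iff]
    subst hc
    decide +kernel
  · refine Or.inr (Or.inr (Or.inr (Or.inr (Or.inr (key ?_)))))
    simp only [Gr6, fromEdgeSet_adj, Set.mem_insert_iff, Set.mem_singleton_iff]
    subst hc
    decide +kernel
  · refine Or.inr (Or.inr (Or.inl (key ?_)))
    simp only [Gr3, fromEdgeSet_adj, Set.mem_insert_iff, Set.mem_singleton_iff]
    subst hc
    decide +kernel
  · refine Or.inl (key ?_)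
    simp only [Gr1, fromEdgeSet_adj, Set.mem_insert_iff, Set.mem_singleton_iff]
    subst hc
    decide +kernel
  · refine Or.inr (Or.inl (key ?_))
    simp only [Gr2, fromEdgeSet_adj, Set.mem_insert_iff, Set.mem_singleton_iff]
    subst hc
    decide +kernel

/-- If the search returns `true`, then every graph that it covers is exceptional. -/
theorem exists_iso_of_search {H : SimpleGraph (Fin 9)} {d s : ℕ} {l : List Step} {p m : ℕ}
    (hH : Admissible d s (encode H)) (hl : l.all (Step.valid s) = true)
    (hp : ∀ i j : Fin 9, adj p i j = true → H.Adj i j)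
    (hm : ∀ i j : Fin 9, H.Adj i j → adj m i j = true) (h : search d l p m = true) :
    ∃ K ∈ ({Gr1, Gr2, Gr3, Gr4, Gr5, Gr6} : Set (SimpleGraph (Fin 9))), Nonempty (H ≃g K) := by
  obtain ⟨g, hg, hgH⟩ := search_sound hH hl (p := p) (m := m)
    (fun i j hi hj hij => (adj_encode H ⟨i, hi⟩ ⟨j, hj⟩).2 (hp ⟨i, hi⟩ ⟨j, hj⟩ hij))
    (fun i j hi hj hij => hm ⟨i, hi⟩ ⟨j, hj⟩ ((adj_encode H ⟨i, hi⟩ ⟨j, hj⟩).1 hij)) h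
  obtain ⟨K, ⟨c, hc, hcK⟩, hK⟩ := exists_exceptional (H := H)
    (fun i j => by rw [hgH i j i.is_lt j.is_lt, adj_encode]) hg
  exact ⟨K, mem_of_exceptionalLabellings hc hcK, hK⟩

variable {V : Type*} {G : SimpleGraph V}

/-- A `4`-cycle of `G` that avoids the closed neighbourhood of `v`. -/
structure FarFourCycle (G : SimpleGraph V) (v : V) (c : Fin 4 → V) : Prop where
  injective : Function.Injective c
  ne : ∀ k, c k ≠ v
  far : ∀ k, ¬ G.Adj v (c k)
  adj : ∀ k, G.Adj (c k) (c (k + 1))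

theorem exists_farFourCycle (h : 2 ≤ isolNum C4 G) (v : V) : ∃ c, FarFourCycle G v c := by
  have hv : HasCopy C4 (G.induce (closedNbhd G {v})ᶜ) := by
    by_contra hv
    have : isolNum C4 G ≤ 1 := Nat.sInf_le ⟨{v}, Set.ncard_singleton v, hv⟩
    omega
  obtain ⟨f, hf⟩ := hv
  have hmem : ∀ k, (f k : V) ≠ v ∧ ¬ G.Adj v (f k) := fun k => by
    have := (f k).2
    simpa [closedNbhd] using this
  refine ⟨fun k => f k, Subtype.val_injective.comp f.injective, fun k => (hmem k).1,
    fun k => (hmem k).2, fun k => ?_⟩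
  have : C4.Adj k (k + 1) := by
    simp [C4, cycleGraph_adj]
  exact hf this

open scoped Classical in
/-- The neighbours of `x` among the values of `c`, as a bit mask. -/
noncomputable def traceKey (G : SimpleGraph V) (c : Fin 4 → V) (x : V) : ℕ :=
  Nat.ofBits fun t => decide (G.Adj x (c t))

theorem exists_sorted {α β : Type*} [LinearOrder β] (s : Finset α) {k : ℕ} (hs : s.card = k)
    (f : α → β) : ∃ n : Fin k → α, Function.Injective n ∧ (∀ i, n i ∈ s) ∧ Monotone (f ∘ n) := by
  let e := (s.equivFinOfCardEq hs).symm
  let g : Fin k → β := fun i => f (e i)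
  refine ⟨fun i => e (Tuple.sort g i), ?_, fun i => (e _).2, Tuple.monotone_sort g⟩
  exact Subtype.val_injective.comp (e.injective.comp (Tuple.sort g).injective)

theorem admissible_comap [Fintype V] {d s : ℕ} (hG : G.Connected)
    (hdeg : ∀ v, (G.neighborSet v).ncard ≤ d) (h : 2 ≤ isolNum C4 G) (e : Fin 9 ≃ V)
    (hs : ∀ i j : Fin 9, s ≤ (i : ℕ) → (i : ℕ) < 4 → (j : ℕ) = i + 1 →
      traceKey G (fun t => e (Fin.natAdd 5 t)) (e i) ≤
        traceKey G (fun t => e (Fin.natAdd 5 t)) (e j)) :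
    Admissible d s (encode (G.comap e)) := by
  classical
  have hadj : ∀ i j : Fin 9, adj (encode (G.comap e)) i j = true ↔ G.Adj (e i) (e j) :=
    fun i j => adj_encode _ i j
  have hkey : ∀ i : Fin 9, key (encode (G.comap e)) i =
      traceKey G (fun t => e (Fin.natAdd 5 t)) (e i) := fun i => by
    apply Nat.eq_of_testBit_eq
    intro t
    rw [testBit_key, traceKey, Nat.testBit_ofBits]
    by_cases ht : t < 4
    · have := hadj i (Fin.natAdd 5 ⟨t, ht⟩)
      simp only [ht, decide_true, Bool.true_and, dif_pos]
      exact Bool.eq_iff_iff.2 (by rw [decide_eq_true_eq, ← this]; rfl)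
    · simp [ht]
  refine ⟨fun i j hi hj hij => ?_, fun i hi => ?_, fun w hw => ?_, fun i hi hi' => ?_,
    fun t ht hcl i hi => ?_⟩
  · exact (hadj ⟨j, hj⟩ ⟨i, hi⟩).2 ((hadj ⟨i, hi⟩ ⟨j, hj⟩).1 hij).symm
  · rw [degLe_iff]
    refine le_trans ?_ (hdeg (e ⟨i, hi⟩))
    rw [← Set.ncard_coe_finset, ← Set.ncard_image_of_injective _ e.injective]
    refine Set.ncard_le_ncard ?_ (Set.toFinite _)
    rintro _ ⟨j, hj, rfl⟩
    exact (hadj ⟨i, hi⟩ j).1 (by simpa using hj)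
  · obtain ⟨c, hc⟩ := exists_farFourCycle h (e ⟨w, hw⟩)
    refine ⟨fun k => e.symm (c k), Fin.val_injective.comp (e.symm.injective.comp hc.injective),
      fun k => Fin.is_lt _, fun k hk => hc.ne k ?_, fun k => ?_, fun k => ?_⟩
    · rw [← e.apply_symm_apply (c k)]
      exact congrArg e (Fin.ext hk)
    · rw [← Bool.not_eq_true]
      intro hk
      have := (hadj ⟨w, hw⟩ _).1 hk
      rw [e.apply_symm_apply] at this
      exact hc.far k this
    · rw [hadj, e.apply_symm_apply, e.apply_symm_apply]
      exact hc.adj k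
  · have := hs ⟨i, by omega⟩ ⟨i + 1, by omega⟩ hi hi' rfl
    rwa [← hkey, ← hkey] at this
  · have hreach : ∀ v, Relation.ReflTransGen G.Adj (e 8) v → t.testBit (e.symm v) = true :=
      fun v hv => by
        induction hv with
        | refl => simpa using ht
        | tail _ hbc ih =>
          refine hcl _ _ (Fin.is_lt _) (Fin.is_lt _) ih ((hadj _ _).2 ?_)
          rwa [e.apply_symm_apply, e.apply_symm_apply]
    have := hreach (e ⟨i, hi⟩) ((reachable_iff_reflTransGen _ _).1 (hG.preconnected _ _))
    rwa [e.symm_apply_apply] at this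

theorem adj_square {c : Fin 4 → V} {e : Fin 9 ≃ V} (hc : ∀ k, G.Adj (c k) (c (k + 1)))
    (he : ∀ k, e (Fin.natAdd 5 k) = c k) {i j : Fin 9}
    (hij : adj (edgesCode squareEdges) i j = true) : G.Adj (e i) (e j) := by
  have key : ∀ i j : Fin 9, adj (edgesCode squareEdges) i j = true → ∃ k : Fin 4,
      i = Fin.natAdd 5 k ∧ j = Fin.natAdd 5 (k + 1) ∨
        j = Fin.natAdd 5 k ∧ i = Fin.natAdd 5 (k + 1) := by
    decide +kernel
  obtain ⟨k, ⟨rfl, rfl⟩ | ⟨rfl, rfl⟩⟩ := key i j hij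
  · rw [he, he]
    exact hc k
  · rw [he, he]
    exact (hc k).symm

/-- The vertices can be labelled by `n` and then `c`. -/
theorem exists_labelling [Fintype V] (hcard : Fintype.card V = 9) {n : Fin 5 → V} {c : Fin 4 → V}
    (hn : Function.Injective n) (hc : Function.Injective c) (hnc : ∀ i k, n i ≠ c k) :
    ∃ e : Fin 9 ≃ V, (∀ i, e (Fin.castAdd 4 i) = n i) ∧ ∀ k, e (Fin.natAdd 5 k) = c k := by
  have hinj : Function.Injective (Fin.append n c) := Fin.append_injective_iff.2 ⟨hn, hc, hnc⟩
  refine ⟨Equiv.ofBijective (Fin.append n c)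
    ((Fintype.bijective_iff_injective_and_card _).2 ⟨hinj, by simp [hcard]⟩), fun i => ?_,
    fun k => ?_⟩
  · exact Fin.append_left n c i
  · exact Fin.append_right n c k

theorem exists_iso_of_ncard_le_three [Fintype V] (hcard : Fintype.card V = 9) (hG : G.Connected)
    (hdeg : ∀ v, (G.neighborSet v).ncard ≤ 3) (h : 2 ≤ isolNum C4 G) :
    ∃ K ∈ ({Gr1, Gr2, Gr3, Gr4, Gr5, Gr6} : Set (SimpleGraph (Fin 9))), Nonempty (G ≃g K) := by
  classical
  obtain ⟨v⟩ := hG.nonempty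
  obtain ⟨c, hc⟩ := exists_farFourCycle h v
  have hs : ((Finset.univ.image c)ᶜ).card = 5 := by
    rw [Finset.card_compl, hcard, Finset.card_image_of_injective _ hc.injective]
    rfl
  obtain ⟨n, hn, hmem, hmono⟩ := exists_sorted _ hs (traceKey G c)
  obtain ⟨e, hen, hec⟩ := exists_labelling hcard hn hc.injective fun i k hik => by
    have := hmem i
    simp [hik] at this
  have hadm : Admissible 3 0 (encode (G.comap e)) := by
    refine admissible_comap hG hdeg h e fun i j _ hi hij => ?_
    have hi5 : e i = n ⟨i, by omega⟩ := hen ⟨i, by omega⟩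
    have hj5 : e j = n ⟨j, by omega⟩ := hen ⟨j, by omega⟩
    simp only [hec, hi5, hj5]
    exact hmono (by simp [hij])
  obtain ⟨K, hK, ⟨f⟩⟩ := exists_iso_of_search hadm (l := stepsThree) (by decide)
    (fun i j hij => adj_square hc.adj hec hij)
    (fun i j hij => by
      have : ∀ i j : Fin 9, i ≠ j → adj fullCode i j = true := by decide +kernel
      exact this i j hij.ne) search_three
  exact ⟨K, hK, ⟨(Iso.comap e G).symm.trans f⟩⟩

theorem exists_iso_of_ncard_eq_four [Fintype V] (hcard : Fintype.card V = 9) (hG : G.Connected)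
    (hdeg : ∀ v, (G.neighborSet v).ncard ≤ 4) {v : V} (hv : (G.neighborSet v).ncard = 4)
    (h : 2 ≤ isolNum C4 G) :
    ∃ K ∈ ({Gr1, Gr2, Gr3, Gr4, Gr5, Gr6} : Set (SimpleGraph (Fin 9))), Nonempty (G ≃g K) := by
  classical
  obtain ⟨c, hc⟩ := exists_farFourCycle h v
  obtain ⟨n, hn, hmem, hmono⟩ := exists_sorted (G.neighborSet v).toFinset
    (by rw [← Set.ncard_eq_toFinset_card', hv]) (traceKey G c)
  have hvn : ∀ i, G.Adj v (n i) := fun i => by simpa using hmem i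
  have hn' : Function.Injective (Fin.cons v n : Fin 5 → V) :=
    Fin.cons_injective_iff.2 ⟨by rintro ⟨i, hi⟩; exact (hvn i).ne hi.symm, hn⟩
  obtain ⟨e, hen, hec⟩ := exists_labelling hcard hn' hc.injective fun i k => by
    refine Fin.cases (hc.ne k).symm (fun i hik => hc.far k ?_) i
    rw [← hik]
    exact hvn i
  have he0 : e 0 = v := hen 0
  have hes : ∀ i : Fin 4, e (Fin.castAdd 4 i.succ) = n i := fun i => hen i.succ
  have hadm : Admissible 4 1 (encode (G.comap e)) := by
    refine admissible_comap hG hdeg h e fun i j hi hi' hij => ?_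
    obtain ⟨a, rfl⟩ : ∃ a : Fin 4, i = Fin.castAdd 4 a.succ :=
      ⟨⟨i - 1, by omega⟩, Fin.ext (by simp; omega)⟩
    obtain ⟨b, rfl⟩ : ∃ b : Fin 4, j = Fin.castAdd 4 b.succ :=
      ⟨⟨j - 1, by omega⟩, Fin.ext (by simp; omega)⟩
    simp only [hec, hes]
    refine hmono (Fin.le_def.2 ?_)
    simp at hij
    omega
  have hp : ∀ i j : Fin 9, adj starSquareCode i j = true →
      adj (edgesCode squareEdges) i j = true ∨
        (∃ a : Fin 4, i = 0 ∧ j = Fin.castAdd 4 a.succ ∨ j = 0 ∧ i = Fin.castAdd 4 a.succ) := by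
    decide +kernel
  have hm : ∀ i j : Fin 9, i ≠ j → adj starSquareBound i j = false →
      ∃ k : Fin 4, i = 0 ∧ j = Fin.natAdd 5 k ∨ j = 0 ∧ i = Fin.natAdd 5 k := by
    decide +kernel
  obtain ⟨K, hK, ⟨f⟩⟩ := exists_iso_of_search hadm (l := stepsFour) (by decide)
    (fun i j hij => by
      obtain hij | ⟨a, ⟨rfl, rfl⟩ | ⟨rfl, rfl⟩⟩ := hp i j hij
      · exact adj_square hc.adj hec hij
      · rw [comap_adj, he0, hes]
        exact hvn a
      · rw [comap_adj, he0, hes]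
        exact (hvn a).symm)
    (fun i j hij => by
      rw [← Bool.not_eq_false]
      intro hn
      obtain ⟨k, ⟨rfl, rfl⟩ | ⟨rfl, rfl⟩⟩ := hm i j hij.ne hn
      · rw [comap_adj, he0, hec] at hij
        exact hc.far k hij
      · rw [comap_adj, he0, hec] at hij
        exact hc.far k hij.symm) search_four
  exact ⟨K, hK, ⟨(Iso.comap e G).symm.trans f⟩⟩

end GraphCode

/-- If `G` is a connected subquartic `9`-vertex graph with `ι(G, C₄) ≥ 2`, then `G` is
isomorphic to one of the six graphs in `𝒢₉`. -/
theorem stmt18 {V : Type*} [Fintype V] (G : SimpleGraph V)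
    (hcard : Fintype.card V = 9) (hG : G.Connected)
    (hdeg : ∀ v, (G.neighborSet v).ncard ≤ 4) (h : 2 ≤ isolNum C4 G) :
    ∃ H ∈ ({Gr1, Gr2, Gr3, Gr4, Gr5, Gr6} : Set (SimpleGraph (Fin 9))),
      Nonempty (G ≃g H) := by
  by_cases h3 : ∀ v, (G.neighborSet v).ncard ≤ 3
  · exact GraphCode.exists_iso_of_ncard_le_three hcard hG h3 h
  · push Not at h3
    obtain ⟨v, hv⟩ := h3
    exact GraphCode.exists_iso_of_ncard_eq_four hcard hG hdeg (le_antisymm (hdeg v) hv) h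
end

section
/- For every natural number n ≥ 1, there exists a connected graph G on n vertices such that every set D ⊆ V(G) for which G − N[D] is acyclic satisfies |D| ≥ ⌊n/4⌋, and some such set D of size ⌊n/4⌋ exists; that is, the minimum size of a set D with G − N[D] acyclic equals ⌊n/4⌋. -/
open SimpleGraph

/-- The index of the block containing vertex `v`: consecutive blocks of four vertices, except that
the last of the `n / 4` blocks also takes the remaining vertices. -/
def blockIndex (n v : ℕ) : ℕ := min (v / 4) (n / 4 - 1)

/-- The graph on `n` vertices whose blocks, given by `blockIndex`, are cliques, and in which the
multiples of four are pairwise adjacent. -/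
def blockGraph (n : ℕ) : SimpleGraph (Fin n) where
  Adj u v := u ≠ v ∧ (blockIndex n u = blockIndex n v ∨ 4 ∣ u.val ∧ 4 ∣ v.val)
  symm := ⟨fun _ _ h => ⟨h.1.symm, h.2.imp Eq.symm And.symm⟩⟩
  loopless := ⟨fun _ h => h.1 rfl⟩

theorem blockIndex_lt {n : ℕ} (hn : 4 ≤ n) (v : ℕ) : blockIndex n v < n / 4 := by
  unfold blockIndex
  omega

theorem four_mul_blockIndex_lt {n : ℕ} (hn : 4 ≤ n) (v : ℕ) : 4 * blockIndex n v < n := by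
  have := blockIndex_lt hn v
  omega

theorem blockIndex_four_mul_add {n j i : ℕ} (hj : j < n / 4) (hi : i < 4) :
    blockIndex n (4 * j + i) = j := by
  unfold blockIndex
  omega

theorem blockGraph_connected {n : ℕ} (hn : 4 ≤ n) : (blockGraph n).Connected := by
  rw [connected_iff_exists_forall_reachable]
  refine ⟨⟨0, by omega⟩, fun v => ?_⟩
  have key : ∀ a b : Fin n, (blockIndex n a = blockIndex n b ∨ 4 ∣ a.val ∧ 4 ∣ b.val) →
      (blockGraph n).Reachable a b := by
    intro a b h
    by_cases hab : a = b
    · rw [hab]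
    · exact Adj.reachable ⟨hab, h⟩
  refine (key _ ⟨4 * blockIndex n v, four_mul_blockIndex_lt hn v⟩ (Or.inr ?_)).trans
    (key _ _ (Or.inl ?_))
  · simp
  · exact blockIndex_four_mul_add (i := 0) (blockIndex_lt hn v) (by omega)

theorem exists_dominating_blockGraph {n : ℕ} (hn : 4 ≤ n) :
    ∃ D : Set (Fin n), D.ncard = n / 4 ∧ closedNbhd (blockGraph n) D = Set.univ := by
  let hub : Fin (n / 4) → Fin n := fun j => ⟨4 * j, by omega⟩
  have hinj : Function.Injective hub := by
    intro a b h
    have : 4 * a.val = 4 * b.val := congrArg Fin.val h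
    exact Fin.ext (by omega)
  refine ⟨Set.range hub, by rw [Set.ncard_range_of_injective hinj, Nat.card_fin], ?_⟩
  refine Set.eq_univ_of_forall fun v => ?_
  have hmem : hub ⟨blockIndex n v, blockIndex_lt hn v⟩ ∈ Set.range hub := ⟨_, rfl⟩
  by_cases hv : hub ⟨blockIndex n v, blockIndex_lt hn v⟩ = v
  · exact Or.inl (hv ▸ hmem)
  · exact Or.inr ⟨_, hmem, hv,
      Or.inl (blockIndex_four_mul_add (i := 0) (blockIndex_lt hn v) (by omega))⟩

theorem exists_mem_blockIndex_eq {n j : ℕ} (hj : j < n / 4) {D : Set (Fin n)}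
    (hD : ((blockGraph n).induce (closedNbhd (blockGraph n) D)ᶜ).IsAcyclic) :
    ∃ v ∈ D, blockIndex n v = j := by
  by_contra! hne
  let t : Fin 3 → Fin n := fun i => ⟨4 * j + (i + 1), by omega⟩
  have hblock : ∀ i, blockIndex n (t i) = j := fun i => blockIndex_four_mul_add hj (by omega)
  have hmem : ∀ i, t i ∈ (closedNbhd (blockGraph n) D)ᶜ := by
    rintro i (hi | ⟨u, hu, -, h | ⟨-, h⟩⟩)
    · exact hne _ hi (hblock i)
    · exact hne u hu (h.trans (hblock i))
    · have : 4 ∣ 4 * j + (i.val + 1) := h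
      omega
  have hadj : ∀ a b, a ≠ b → ((blockGraph n).induce (closedNbhd (blockGraph n) D)ᶜ).Adj
      ⟨t a, hmem a⟩ ⟨t b, hmem b⟩ := by
    intro a b hab
    refine ⟨fun h => hab (Fin.ext ?_), Or.inl ((hblock a).trans (hblock b).symm)⟩
    have : 4 * j + (a.val + 1) = 4 * j + (b.val + 1) := congrArg Fin.val h
    omega
  classical
  exact hD.cliqueFree le_rfl _ (is3Clique_iff.2 ⟨_, _, _, hadj 0 1 (by decide),
    hadj 0 2 (by decide), hadj 1 2 (by decide), rfl⟩)

/-- For every `n ≥ 1` there is a connected `n`-vertex graph `G` such that the minimum size of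
a set `D ⊆ V(G)` with `G − N[D]` acyclic equals `⌊n/4⌋`. -/
theorem stmt19 (n : ℕ) (hn : 1 ≤ n) :
    ∃ G : SimpleGraph (Fin n), G.Connected ∧
      (∃ D : Set (Fin n), D.ncard = n / 4 ∧ (G.induce (closedNbhd G D)ᶜ).IsAcyclic) ∧
      (∀ D : Set (Fin n), (G.induce (closedNbhd G D)ᶜ).IsAcyclic → n / 4 ≤ D.ncard) := by
  rcases lt_or_ge n 4 with h4 | h4
  · have : Nonempty (Fin n) := ⟨⟨0, hn⟩⟩
    obtain ⟨T, -, hT⟩ := (connected_top (V := Fin n)).exists_isTree_le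
    have h0 : n / 4 = 0 := Nat.div_eq_of_lt h4
    exact ⟨T, hT.connected, ⟨∅, by simp [h0], hT.isAcyclic.induce _⟩, by simp [h0]⟩
  · refine ⟨blockGraph n, blockGraph_connected h4, ?_, fun D hD => ?_⟩
    · obtain ⟨D, hcard, hdom⟩ := exists_dominating_blockGraph h4
      refine ⟨D, hcard, ?_⟩
      rw [hdom, Set.compl_univ]
      exact IsAcyclic.of_subsingleton
    · have hsub : Set.Iio (n / 4) ⊆ (fun v : Fin n => blockIndex n v) '' D :=
        fun _ hj => exists_mem_blockIndex_eq hj hD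
      calc n / 4 = (Set.Iio (n / 4)).ncard := by simp
        _ ≤ ((fun v : Fin n => blockIndex n v) '' D).ncard :=
          Set.ncard_le_ncard hsub (D.toFinite.image _)
        _ ≤ D.ncard := Set.ncard_image_le
end
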